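/- arXiv:1511.08724 — 4 statements merged into one kernel-verified Lean document; each statement's English description precedes it below -/
import Mathlib

section
/- Every reducible task is learnable under fairness: for every task T = (Q, Q₀, A, rewards, δ) such that Q is reducible to goals(T), every fair run on T converges. -/
/-!
Formalization of the navigational reinforcement learning framework of
Ameloot & Van den Bussche, "On the convergence of cycle detection for
navigational reinforcement learning".
-/

/-- A task `T = (Q, Q₀, A, rewards, δ)`: `Q` and `A` are (finite, nonempty) types,
`start` is a nonempty set of start states, `rewards` a nonempty set of
state-action pairs and `delta` maps each state-action pair to a nonempty
set of successor states. -/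
structure NavTask (Q A : Type) where
  start : Set Q
  start_nonempty : start.Nonempty
  rewards : Set (Q × A)
  rewards_nonempty : rewards.Nonempty
  delta : Q → A → Set Q
  delta_nonempty : ∀ q a, (delta q a).Nonempty

namespace NavTask

variable {Q A : Type}

/-- The goal states of a task. -/
def goals (T : NavTask Q A) : Set Q := {q | ∃ a, (q, a) ∈ T.rewards}

/-- The reducibility layers relative to a set `S`; `layers S 0` is the layer `F₁ = S`
of the paper, and `layers S n` is the layer `F_{n+1}`. -/
def layers (T : NavTask Q A) (S : Set Q) : ℕ → Set Q
  | 0 => S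
  | n + 1 => T.layers S n ∪ {q | ∃ a, T.delta q a ⊆ T.layers S n}

/-- `S'` is reducible to `S`. -/
def ReducibleTo (T : NavTask Q A) (S' S : Set Q) : Prop := S' ⊆ ⋃ n, T.layers S n

/-- `reduce T`: the set of states reducible to the goal states. -/
def reduce (T : NavTask Q A) : Set Q := ⋃ n, T.layers T.goals n

/-- A task is reducible if all states are reducible to the goal states. -/
def Reducible (T : NavTask Q A) : Prop := T.ReducibleTo Set.univ T.goals

end NavTask

/-- A configuration `(q, π, V)`: current state, policy, working memory. -/
structure Config (Q A : Type) where
  state : Q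
  pol : Q → A
  mem : Set Q

namespace Config

variable {Q A : Type}

/-- A configuration is branching if its current state has already been visited. -/
def Branching (c : Config Q A) : Prop := c.state ∈ c.mem

/-- Applying an option `(a, q')` to a configuration: move to `q'`, record action `a`
for the departed state, and mark the departed state as visited. -/
noncomputable def apply (c : Config Q A) (a : A) (q' : Q) : Config Q A :=
  letI := Classical.decEq Q
  ⟨q', Function.update c.pol c.state a, c.mem ∪ {c.state}⟩

end Config

/-- A transition: a four-tuple (source configuration, action, chosen successor
state, target configuration). -/
structure Step (Q A : Type) where
  src : Config Q A
  act : A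
  nxt : Q
  tgt : Config Q A

namespace NavTask

variable {Q A : Type}

/-- The options of a configuration: all actions if branching, otherwise only
the action given by the policy, paired with possible successor states. -/
def opts (T : NavTask Q A) (c : Config Q A) : Set (A × Q) :=
  {p | (c.Branching ∨ p.1 = c.pol c.state) ∧ p.2 ∈ T.delta c.state p.1}

/-- Validity of a transition. -/
def ValidStep (T : NavTask Q A) (t : Step Q A) : Prop :=
  (t.act, t.nxt) ∈ T.opts t.src ∧ t.tgt = t.src.apply t.act t.nxt

/-- A reward transition. -/
def IsRewardStep (T : NavTask Q A) (t : Step Q A) : Prop :=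
  (t.src.state, t.act) ∈ T.rewards

end NavTask

/-- A finite list of transitions is a chain: each target is the next source. -/
def IsChainList {Q A : Type} (l : List (Step Q A)) : Prop :=
  ∀ i (h : i + 1 < l.length),
    (l[i]'(Nat.lt_of_succ_lt h)).tgt = (l[i + 1]'h).src

/-- The first (source) configuration of a finite chain, if any. -/
def firstSrc? {Q A : Type} (l : List (Step Q A)) : Option (Config Q A) :=
  l.head?.map Step.src

/-- The last (target, i.e. terminal) configuration of a finite chain, if any. -/
def lastTgt? {Q A : Type} (l : List (Step Q A)) : Option (Config Q A) :=
  l.getLast?.map Step.tgt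

namespace NavTask

variable {Q A : Type}

/-- A finite trial: a nonempty valid chain ending with a reward transition and
containing no other reward transitions. -/
def IsFinTrial (T : NavTask Q A) (l : List (Step Q A)) : Prop :=
  l ≠ [] ∧ IsChainList l ∧ (∀ t ∈ l, T.ValidStep t) ∧
  (∀ t ∈ l.getLast?, T.IsRewardStep t) ∧
  (∀ i (h : i + 1 < l.length), ¬ T.IsRewardStep (l[i]'(Nat.lt_of_succ_lt h)))

/-- An infinite trial: an infinite valid chain with no reward transitions. -/
def IsInfTrial (T : NavTask Q A) (g : ℕ → Step Q A) : Prop :=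
  (∀ n, T.ValidStep (g n)) ∧ (∀ n, (g n).tgt = (g (n + 1)).src) ∧
  (∀ n, ¬ T.IsRewardStep (g n))

/-- A start configuration: a start state with empty working memory. -/
def IsStartConfig (T : NavTask Q A) (c : Config Q A) : Prop :=
  c.state ∈ T.start ∧ c.mem = ∅

/-- When a trial ends with `c₁`, the next trial starts with a configuration `c₂`
whose state is a start state, with the same policy, and empty working memory. -/
def Succession (T : NavTask Q A) (c₁ c₂ : Config Q A) : Prop :=
  c₂.state ∈ T.start ∧ c₂.pol = c₁.pol ∧ c₂.mem = ∅

end NavTask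

/-- A trial is either a finite or an infinite chain of transitions. -/
inductive Trial (Q A : Type) where
  | fin : List (Step Q A) → Trial Q A
  | inf : (ℕ → Step Q A) → Trial Q A

namespace Trial

variable {Q A : Type}

/-- A trial is finite (terminates). -/
def IsFinite : Trial Q A → Prop
  | .fin _ => True
  | .inf _ => False

/-- The configuration occurring at (0-based) position `n` of a trial: sources of
the transitions, plus (for a finite trial) the terminal configuration. -/
def config? : Trial Q A → ℕ → Option (Config Q A)
  | .fin l, n =>
      if h : n < l.length then some (l[n]'h).src
      else if n = l.length then lastTgt? l else none
  | .inf g, n => some (g n).src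

/-- Position `n` of a trial is non-terminal. -/
def NonTerminal : Trial Q A → ℕ → Prop
  | .fin l, n => n < l.length
  | .inf _, _ => True

/-- The positions at which state `q` occurs in a trial. -/
def stateOccs (tr : Trial Q A) (q : Q) : Set ℕ :=
  {n | ∃ c ∈ tr.config? n, c.state = q}

end Trial

/-- Validity of a trial. -/
def NavTask.IsTrial {Q A : Type} (T : NavTask Q A) : Trial Q A → Prop
  | .fin l => T.IsFinTrial l
  | .inf g => T.IsInfTrial g

/-- A run: either an infinite sequence of finite trials, or finitely many finite
trials followed by one infinite trial. -/
inductive Run (Q A : Type) where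
  | allFin : (ℕ → List (Step Q A)) → Run Q A
  | withInf : List (List (Step Q A)) → (ℕ → Step Q A) → Run Q A

/-- Validity of a run on a task. -/
def NavTask.IsRun {Q A : Type} (T : NavTask Q A) : Run Q A → Prop
  | .allFin f =>
      (∀ n, T.IsFinTrial (f n)) ∧
      (∀ c ∈ firstSrc? (f 0), T.IsStartConfig c) ∧
      (∀ n, ∀ c₁ ∈ lastTgt? (f n), ∀ c₂ ∈ firstSrc? (f (n + 1)), T.Succession c₁ c₂) ∧
      (∀ q ∈ T.start, {n | ∃ c ∈ firstSrc? (f n), c.state = q}.Infinite)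
  | .withInf L g =>
      (∀ l ∈ L, T.IsFinTrial l) ∧ T.IsInfTrial g ∧
      (L = [] → T.IsStartConfig (g 0).src) ∧
      (∀ l ∈ L.head?, ∀ c ∈ firstSrc? l, T.IsStartConfig c) ∧
      (∀ i (h : i + 1 < L.length),
        ∀ c₁ ∈ lastTgt? (L[i]'(Nat.lt_of_succ_lt h)),
        ∀ c₂ ∈ firstSrc? (L[i + 1]'h), T.Succession c₁ c₂) ∧
      (∀ c₁ ∈ lastTgt? (L.getLast?.getD []), T.Succession c₁ (g 0).src)

namespace Run

variable {Q A : Type}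

/-- The trials of a run. -/
def trials : Run Q A → Set (Trial Q A)
  | .allFin f => {tr | ∃ n, tr = .fin (f n)}
  | .withInf L g => {tr | (∃ l ∈ L, tr = .fin l) ∨ tr = .inf g}

/-- `P` holds at infinitely many transitions (equivalently, non-terminal
configuration occurrences) of the run, restricted to trials of index `≥ i`. -/
def InfOftenFrom : Run Q A → ℕ → (Step Q A → Prop) → Prop
  | .allFin f, i, P =>
      {p : ℕ × ℕ | i ≤ p.1 ∧ ∃ h : p.2 < (f p.1).length, P ((f p.1)[p.2]'h)}.Infinite
  | .withInf L g, i, P => i ≤ L.length ∧ {n | P (g n)}.Infinite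

/-- `P` holds at infinitely many transitions of the run. -/
def InfOften (R : Run Q A) (P : Step Q A → Prop) : Prop := R.InfOftenFrom 0 P

/-- A state is stable: only finitely many non-terminal occurrences of branching
configurations containing it. -/
def Stable (R : Run Q A) (q : Q) : Prop :=
  ¬ R.InfOften (fun t => t.src.state = q ∧ t.src.Branching)

/-- All trials of the run are finite. -/
def AllFinite : Run Q A → Prop
  | .allFin _ => True
  | .withInf _ _ => False

/-- A run converges: all trials terminate (with reward) and every state
eventually becomes stable. -/
def Converges (R : Run Q A) : Prop := R.AllFinite ∧ ∀ q, R.Stable q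

/-- Only finitely many trials contain more than `k` non-terminal configurations;
equivalently, from some trial index on, every trial has at most `k`
non-terminal configurations (sources of transitions). -/
def EventuallyBounded : Run Q A → ℕ → Prop
  | .allFin f, k => {n | k < (f n).length}.Finite
  | .withInf _ _, _ => False

/-- After trial `i` there are no more branching configurations at
non-terminal positions. -/
def NoBranchingAfter : Run Q A → ℕ → Prop
  | .allFin f, i => ∀ m, i < m → ∀ t ∈ f m, ¬ t.src.Branching
  | .withInf L g, i =>
      (∀ m, i < m → ∀ l ∈ L[m]?, ∀ t ∈ l, ¬ t.src.Branching) ∧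
      (i < L.length → ∀ n, ¬ (g n).src.Branching)

/-- Trial `i` of the run terminates (is finite). -/
def TrialTerminates : Run Q A → ℕ → Prop
  | .allFin _, _ => True
  | .withInf L _, i => i < L.length

/-- `i` is the convergence-trial index: the smallest trial index such that trial `i`
terminates and after trial `i` there are no branching configurations at
non-terminal positions. -/
def IsConvIndex (R : Run Q A) (i : ℕ) : Prop :=
  R.TrialTerminates i ∧ R.NoBranchingAfter i ∧
  ∀ j < i, ¬ (R.TrialTerminates j ∧ R.NoBranchingAfter j)

/-- `π` is the policy at the end of trial `i` of the run. -/
def EndPolicyAt : Run Q A → ℕ → (Q → A) → Prop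
  | .allFin f, i, π => ∃ t ∈ (f i).getLast?, t.tgt.pol = π
  | .withInf L _, i, π => ∃ l ∈ L[i]?, ∃ t ∈ l.getLast?, t.tgt.pol = π

/-- `π` is the final policy of the run: the policy at the end of the
convergence-trial. -/
def IsFinalPolicy (R : Run Q A) (π : Q → A) : Prop :=
  ∃ i, R.IsConvIndex i ∧ R.EndPolicyAt i π

/-- `π` occurs in the run at the end of some trial. -/
def EndsPolicy (R : Run Q A) (π : Q → A) : Prop := ∃ i, R.EndPolicyAt i π

end Run

namespace NavTask

variable {Q A : Type}

/-- Fairness: every configuration occurring infinitely often at non-terminal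
positions has each of its options taken infinitely often. -/
def Fair (T : NavTask Q A) (R : Run Q A) : Prop :=
  ∀ c : Config Q A, R.InfOften (fun t => t.src = c) →
    ∀ p ∈ T.opts c,
      R.InfOften (fun t => t = ⟨c, p.1, p.2, c.apply p.1 p.2⟩)

/-- A task is learnable under fairness if every fair run on it converges. -/
def Learnable (T : NavTask Q A) : Prop :=
  ∀ R : Run Q A, T.IsRun R → T.Fair R → R.Converges

/-- `ground π`: goal states assigned a rewarding action by the policy. -/
def ground (T : NavTask Q A) (π : Q → A) : Set Q := {q | (q, π q) ∈ T.rewards}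

/-- The forward layers of a policy; `fwd π 0` is `F₁ = Q₀` of the paper. -/
def fwd (T : NavTask Q A) (π : Q → A) : ℕ → Set Q
  | 0 => T.start
  | n + 1 => T.fwd π n ∪ ⋃ q ∈ T.fwd π n \ T.ground π, T.delta q (π q)

/-- `forward π`: states reachable from the start states by following `π`. -/
def forward (T : NavTask Q A) (π : Q → A) : Set Q := ⋃ n, T.fwd π n

/-- The backward layers of a policy; `bwd π 0` is `B₁ = ground(π)` of the paper. -/
def bwd (T : NavTask Q A) (π : Q → A) : ℕ → Set Q
  | 0 => T.ground π
  | n + 1 => T.bwd π n ∪ {q | T.delta q (π q) ⊆ T.bwd π n}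

/-- `backward π`: states reduced by `π` to the goal states in `ground π`. -/
def backward (T : NavTask Q A) (π : Q → A) : Set Q := ⋃ n, T.bwd π n

/-- A (simple) path from `q` to `q'`: non-reward transitions, pairwise distinct
states. -/
def Path (T : NavTask Q A) (q q' : Q) : Prop :=
  ∃ (n : ℕ) (s : ℕ → Q) (a : ℕ → A),
    s 0 = q ∧ s n = q' ∧
    (∀ i < n, s (i + 1) ∈ T.delta (s i) (a i)) ∧
    (∀ i < n, (s i, a i) ∉ T.rewards) ∧
    (∀ i ≤ n, ∀ j ≤ n, i ≠ j → s i ≠ s j)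

/-- A state is reachable: there is a path from some start state to it. -/
def Reachable (T : NavTask Q A) (q : Q) : Prop := ∃ q₀ ∈ T.start, T.Path q₀ q

/-- A state has a path to a set `S`. -/
def HasPathTo (T : NavTask Q A) (q : Q) (S : Set Q) : Prop := ∃ q' ∈ S, T.Path q q'

end NavTask

namespace NavTask

variable {Q A : Type} {T : NavTask Q A}

theorem bwd_mono (T : NavTask Q A) (π : Q → A) : Monotone (T.bwd π) :=
  monotone_nat_of_le_succ fun _ => Set.subset_union_left

theorem exists_delta_subset_bwd {π : Q → A} {q : Q} (hq : q ∉ T.ground π) :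
    ∀ {k : ℕ}, q ∈ T.bwd π k → ∃ j < k, T.delta q (π q) ⊆ T.bwd π j
  | 0, h => absurd h hq
  | k + 1, h => by
    rcases h with h | h
    · obtain ⟨j, hj, hsub⟩ := exists_delta_subset_bwd hq h
      exact ⟨j, by omega, hsub⟩
    · exact ⟨k, by omega, h⟩

theorem ground_subset_backward (T : NavTask Q A) (π : Q → A) : T.ground π ⊆ T.backward π :=
  Set.subset_iUnion (T.bwd π) 0

theorem mem_backward_of_delta_subset [Finite Q] {π : Q → A} {q : Q}
    (h : T.delta q (π q) ⊆ T.backward π) : q ∈ T.backward π := by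
  obtain ⟨k, hk⟩ := (T.bwd_mono π).directed_le.exists_mem_subset_of_finset_subset_biUnion
    (s := (Set.toFinite (T.delta q (π q))).toFinset) (by simpa [backward] using h)
  exact Set.mem_iUnion.2 ⟨k + 1, Or.inr (by simpa using hk)⟩

theorem backward_subset_of_agree {π π' : Q → A} (h : ∀ x ∈ T.backward π, π' x = π x) :
    T.backward π ⊆ T.backward π' := by
  have key : ∀ k, T.bwd π k ⊆ T.bwd π' k := by
    intro k
    induction k with
    | zero =>
      intro x hx
      have := h x (T.ground_subset_backward π hx)
      simpa [bwd, ground, this] using hx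
    | succ k ih =>
      intro x hx
      have hx' := h x (Set.mem_iUnion.2 ⟨_, hx⟩)
      rcases hx with hx | hx
      · exact Or.inl (ih hx)
      · exact Or.inr (by simpa only [Set.mem_ofPred_eq, hx'] using hx.trans ih)
  exact Set.iUnion_mono key

theorem ValidStep.tgt_pol_eq {t : Step Q A} (ht : T.ValidStep t) (hb : ¬ t.src.Branching) :
    t.tgt.pol = t.src.pol := by
  have := ht.1.1.resolve_left hb
  simp only at this
  rw [ht.2, Config.apply, this]
  simp

theorem ValidStep.tgt_pol_self {t : Step Q A} (ht : T.ValidStep t) :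
    t.tgt.pol t.src.state = t.act := by
  rw [ht.2, Config.apply]; simp

theorem ValidStep.tgt_pol_of_ne {t : Step Q A} (ht : T.ValidStep t) {x : Q}
    (hx : x ≠ t.src.state) : t.tgt.pol x = t.src.pol x := by
  rw [ht.2, Config.apply]; simp [hx]

theorem ValidStep.tgt_state {t : Step Q A} (ht : T.ValidStep t) : t.tgt.state = t.nxt := by
  rw [ht.2, Config.apply]

theorem ValidStep.tgt_mem {t : Step Q A} (ht : T.ValidStep t) :
    t.tgt.mem = t.src.mem ∪ {t.src.state} := by
  rw [ht.2, Config.apply]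

/-- The policy of `c` agrees with `π` on `backward π`, and the current state lies in a strictly
lower backward layer than every visited state of `backward π`. -/
def Descends (T : NavTask Q A) (π : Q → A) (c : Config Q A) : Prop :=
  (∀ x ∈ T.backward π, c.pol x = π x) ∧
    ∀ x ∈ c.mem, ∀ k, x ∈ T.bwd π k → ∃ j < k, c.state ∈ T.bwd π j

theorem Descends.not_branching {π : Q → A} {c : Config Q A} (h : T.Descends π c)
    (hc : c.state ∈ T.backward π) : ¬ c.Branching := by
  intro hb
  obtain ⟨k, hk⟩ := Set.mem_iUnion.1 hc
  induction k using Nat.strong_induction_on with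
  | _ k ih =>
    obtain ⟨j, hj, hj'⟩ := h.2 _ hb k hk
    exact ih j hj hj'

theorem Descends.tgt_agree {π : Q → A} {t : Step Q A} (h : T.Descends π t.src)
    (ht : T.ValidStep t) : ∀ x ∈ T.backward π, t.tgt.pol x = π x := by
  intro x hx
  by_cases hxs : x = t.src.state
  · subst hxs
    rw [ht.tgt_pol_eq (h.not_branching hx), h.1 _ hx]
  · rw [ht.tgt_pol_of_ne hxs, h.1 _ hx]

theorem Descends.exists_lt {π : Q → A} {t : Step Q A} (h : T.Descends π t.src)
    (ht : T.ValidStep t) (hr : ¬ T.IsRewardStep t) {k : ℕ} (hk : t.src.state ∈ T.bwd π k) :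
    ∃ j < k, t.tgt.state ∈ T.bwd π j := by
  have hB : t.src.state ∈ T.backward π := Set.mem_iUnion.2 ⟨k, hk⟩
  have hact : t.act = π t.src.state := by rw [← ht.tgt_pol_self, h.tgt_agree ht _ hB]
  have hg : t.src.state ∉ T.ground π := fun h => hr <| by
    rw [IsRewardStep, hact]
    exact h
  obtain ⟨j, hj, hsub⟩ := exists_delta_subset_bwd hg hk
  have := ht.1.2
  simp only [hact] at this
  exact ⟨j, hj, ht.tgt_state ▸ hsub this⟩

theorem Descends.step {π : Q → A} {t : Step Q A} (h : T.Descends π t.src)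
    (ht : T.ValidStep t) (hr : ¬ T.IsRewardStep t) : T.Descends π t.tgt := by
  refine ⟨h.tgt_agree ht, ?_⟩
  rw [ht.tgt_mem]
  rintro x (hx | rfl) k hk
  · obtain ⟨j, hj, hj'⟩ := h.2 x hx k hk
    obtain ⟨i, hi, hi'⟩ := h.exists_lt ht hr hj'
    exact ⟨i, hi.trans hj, hi'⟩
  · exact h.exists_lt ht hr hk

theorem Descends.tgt_mem_backward {π : Q → A} {t : Step Q A} (h : T.Descends π t.src)
    (ht : T.ValidStep t) (hr : ¬ T.IsRewardStep t) (hB : t.src.state ∈ T.backward π) :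
    t.tgt.state ∈ T.backward π := by
  obtain ⟨k, hk⟩ := Set.mem_iUnion.1 hB
  obtain ⟨j, -, hj⟩ := h.exists_lt ht hr hk
  exact Set.mem_iUnion.2 ⟨j, hj⟩

theorem IsFinTrial.length_pos {l : List (Step Q A)} (hl : T.IsFinTrial l) : 0 < l.length :=
  List.length_pos_iff.2 hl.1

theorem IsFinTrial.valid {l : List (Step Q A)} (hl : T.IsFinTrial l) {i : ℕ}
    (hi : i < l.length) : T.ValidStep l[i] :=
  hl.2.2.1 _ (List.getElem_mem hi)

theorem IsFinTrial.succ_lt {l : List (Step Q A)} (hl : T.IsFinTrial l) {i : ℕ}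
    (hi : i < l.length) (hr : ¬ T.IsRewardStep l[i]) : i + 1 < l.length := by
  by_contra hlt
  refine hr (hl.2.2.2.1 _ ?_)
  obtain rfl : i = l.length - 1 := by omega
  simp [List.getLast?_eq_getElem?, List.getElem?_eq_getElem hi]

/-- Induction along a trial from a position `i` on. -/
theorem IsFinTrial.induction {l : List (Step Q A)} (hl : T.IsFinTrial l)
    {P : Config Q A → Prop} {i : ℕ} (hi : i < l.length) (h : P l[i].src)
    (hstep : ∀ t, T.ValidStep t → ¬ T.IsRewardStep t → P t.src → P t.tgt) :
    ∀ j, i ≤ j → ∀ hj : j < l.length, P l[j].src := by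
  intro j hij
  induction j, hij using Nat.le_induction with
  | base => exact fun _ => h
  | succ j _ ih =>
    intro hj
    rw [← hl.2.1 j hj]
    exact hstep _ (hl.valid _) (hl.2.2.2.2 j hj) (ih _)

end NavTask

instance Config.instFinite {Q A : Type} [Finite Q] [Finite A] : Finite (Config Q A) :=
  Finite.of_injective (fun c : Config Q A => (c.state, c.pol, c.mem)) <| by
    rintro ⟨_, _, _⟩ ⟨_, _, _⟩ h
    simpa using h

theorem Set.Infinite.exists_infinite_fiber {α : Type*} [Finite α] {s : Set ℕ} (hs : s.Infinite)
    (g : ℕ → α) : ∃ a, {n | n ∈ s ∧ g n = a}.Infinite := by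
  by_contra! h
  refine hs ((Set.finite_iUnion fun a => h a).subset fun n hn => ?_)
  exact Set.mem_iUnion.2 ⟨g n, hn, rfl⟩

theorem Run.infOften_allFin_iff {Q A : Type} {f : ℕ → List (Step Q A)} {P : Step Q A → Prop} :
    (Run.allFin f).InfOften P ↔
      ∀ N, ∃ n ≥ N, ∃ i, ∃ h : i < (f n).length, P ((f n)[i]'h) := by
  constructor
  · intro h N
    by_contra! hN
    refine h (((Set.finite_Iio N).biUnion fun n _ =>
      (Set.finite_Iio (f n).length).image (Prod.mk n)).subset ?_)
    rintro ⟨n, i⟩ ⟨-, hi, hP⟩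
    have hn : n < N := by
      by_contra hn
      exact hN n (by omega) i hi hP
    exact Set.mem_biUnion hn ⟨i, hi, rfl⟩
  · intro h
    refine Set.Infinite.of_image Prod.fst (Set.infinite_of_forall_exists_gt fun N => ?_)
    obtain ⟨n, hn, i, hi, hP⟩ := h (N + 1)
    exact ⟨n, ⟨(n, i), ⟨Nat.zero_le _, hi, hP⟩, rfl⟩, by omega⟩

namespace NavTask

variable {Q A : Type} {T : NavTask Q A}

/-- In a reducible task, a set of configurations whose states have no rewarding action and that can
follow every action into itself is empty. -/
theorem Reducible.false_of_closed (hred : T.Reducible) {M : Set (Config Q A)}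
    (hM : M.Nonempty) (hrew : ∀ c ∈ M, ∀ a, (c.state, a) ∉ T.rewards)
    (hclosed : ∀ c ∈ M, ∀ a, ∃ q' ∈ T.delta c.state a, ∃ c' ∈ M, c'.state = q') : False := by
  have key : ∀ n, ∀ c ∈ M, c.state ∉ T.layers T.goals n := by
    intro n
    induction n with
    | zero => exact fun c hc ⟨a, ha⟩ => hrew c hc a ha
    | succ n ih =>
      rintro c hc (h | ⟨a, ha⟩)
      · exact ih c hc h
      · obtain ⟨q', hq', c', hc', rfl⟩ := hclosed c hc a
        exact ih c' hc' (ha hq')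
  obtain ⟨c, hc⟩ := hM
  obtain ⟨n, hn⟩ := Set.mem_iUnion.1 (hred (Set.mem_univ c.state))
  exact key n c hc hn

theorem IsInfTrial.mem_mono {g : ℕ → Step Q A} (hg : T.IsInfTrial g) :
    Monotone fun n => (g n).src.mem :=
  monotone_nat_of_le_succ fun n => by
    rw [← hg.2.1 n, (hg.1 n).tgt_mem]
    exact Set.subset_union_left

theorem not_fair_withInf [Finite Q] [Finite A] (hred : T.Reducible) {L : List (List (Step Q A))}
    {g : ℕ → Step Q A} (hg : T.IsInfTrial g) : ¬ T.Fair (.withInf L g) := by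
  intro hfair
  have hopt : ∀ c : Config Q A, {n | (g n).src = c}.Infinite → ∀ a, ∀ q' ∈ T.delta c.state a,
      {n | g n = ⟨c, a, q', c.apply a q'⟩}.Infinite := by
    intro c hc a q' hq'
    obtain ⟨m, hm⟩ := hc.nonempty
    obtain ⟨n, hn, hmn⟩ := hc.exists_gt m
    simp only [Set.mem_ofPred_eq] at hm hn
    have hb : c.state ∈ c.mem := by
      have : (g (m + 1)).src.mem ⊆ (g n).src.mem := hg.mem_mono hmn
      rw [hn, ← hg.2.1 m, (hg.1 m).tgt_mem, hm] at this
      exact this (Or.inr rfl)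
    exact (hfair c ⟨Nat.zero_le _, hc⟩ (a, q') ⟨Or.inl hb, hq'⟩).2
  refine hred.false_of_closed (M := {c | {n | (g n).src = c}.Infinite}) ?_ ?_ ?_
  · obtain ⟨c, hc⟩ := Set.infinite_univ.exists_infinite_fiber fun n => (g n).src
    exact ⟨c, hc.mono fun n hn => hn.2⟩
  · intro c hc a ha
    obtain ⟨q', hq'⟩ := T.delta_nonempty c.state a
    obtain ⟨n, hn⟩ := (hopt c hc a q' hq').nonempty
    refine hg.2.2 n ?_
    rw [Set.mem_ofPred_eq] at hn
    simpa [hn, IsRewardStep] using ha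
  · intro c hc a
    obtain ⟨q', hq'⟩ := T.delta_nonempty c.state a
    refine ⟨q', hq', c.apply a q', ?_, rfl⟩
    refine ((hopt c hc a q' hq').image (Set.injOn_of_injective Nat.succ_injective)).mono ?_
    rintro _ ⟨n, hn, rfl⟩
    rw [Set.mem_ofPred_eq] at hn
    simp only [Set.mem_ofPred_eq, Nat.succ_eq_add_one, ← hg.2.1 n, hn]

/-- `s n` is the first configuration of trial `f n` in a run consisting of finite trials. -/
structure StartsAt (T : NavTask Q A) (f : ℕ → List (Step Q A)) (s : ℕ → Config Q A) : Prop where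
  trial : ∀ n, T.IsFinTrial (f n)
  head : ∀ n (h : 0 < (f n).length), ((f n)[0]'h).src = s n
  mem : ∀ n, (s n).mem = ∅
  state : ∀ n, (s n).state ∈ T.start
  pol : ∀ n i (h : i < (f n).length), i + 1 = (f n).length →
    ((f n)[i]'h).tgt.pol = (s (n + 1)).pol
  infinite : ∀ q ∈ T.start, {n | (s n).state = q}.Infinite

theorem IsRun.exists_startsAt {f : ℕ → List (Step Q A)} (h : T.IsRun (.allFin f)) :
    ∃ s, T.StartsAt f s := by
  obtain ⟨hf, h0, hsucc, hinf⟩ := h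
  have hfirst : ∀ n, firstSrc? (f n) = some ((f n)[0]'(hf n).length_pos).src := fun n => by
    simp [firstSrc?, List.head?_eq_getElem?, List.getElem?_eq_getElem (hf n).length_pos]
  have hlast : ∀ n i (h : i < (f n).length), i + 1 = (f n).length →
      lastTgt? (f n) = some ((f n)[i]'h).tgt := fun n i h hi => by
    obtain rfl : i = (f n).length - 1 := by omega
    simp [lastTgt?, List.getLast?_eq_getElem?, List.getElem?_eq_getElem h]
  have hS : ∀ n i (h : i < (f n).length), i + 1 = (f n).length →
      T.Succession ((f n)[i]'h).tgt ((f (n + 1))[0]'(hf (n + 1)).length_pos).src :=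
    fun n i h hi => hsucc n _ (hlast n i h hi) _ (hfirst (n + 1))
  have hS' : ∀ n, T.IsStartConfig ((f n)[0]'(hf n).length_pos).src := by
    rintro (_ | n)
    · exact h0 _ (hfirst 0)
    · have hpos := (hf n).length_pos
      have := hS n ((f n).length - 1) (by omega) (by omega)
      exact ⟨this.1, this.2.2⟩
  refine ⟨fun n => ((f n)[0]'(hf n).length_pos).src, hf, fun _ _ => rfl, fun n => (hS' n).2,
    fun n => (hS' n).1, fun n i h hi => (hS n i h hi).2.1.symm, fun q hq => ?_⟩
  simpa [hfirst] using hinf q hq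

namespace StartsAt

variable {f : ℕ → List (Step Q A)} {s : ℕ → Config Q A}

theorem descends (h : T.StartsAt f s) (n : ℕ) {i : ℕ} (hi : i < (f n).length) :
    T.Descends (s n).pol ((f n)[i]'hi).src := by
  refine (h.trial n).induction (h.trial n).length_pos (P := T.Descends (s n).pol) ?_
    (fun t ht hr hd => hd.step ht hr) i (Nat.zero_le _) hi
  rw [h.head]
  exact ⟨fun _ _ => rfl, by simp [h.mem]⟩

theorem pol_agree (h : T.StartsAt f s) (n : ℕ) :
    ∀ x ∈ T.backward (s n).pol, (s (n + 1)).pol x = (s n).pol x := by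
  have hpos := (h.trial n).length_pos
  have hlt : (f n).length - 1 < (f n).length := by omega
  rw [← h.pol n _ hlt (by omega)]
  exact (h.descends n hlt).tgt_agree ((h.trial n).valid hlt)

theorem monotone_backward (h : T.StartsAt f s) : Monotone fun n => T.backward (s n).pol :=
  monotone_nat_of_le_succ fun n => backward_subset_of_agree (h.pol_agree n)

/-- Once a trial enters `backward` of its initial policy, the policy no longer changes. -/
theorem pol_eq_of_mem_backward (h : T.StartsAt f s) (n : ℕ) {i : ℕ} (hi : i < (f n).length)
    (hB : ((f n)[i]'hi).src.state ∈ T.backward (s n).pol) :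
    (s (n + 1)).pol = ((f n)[i]'hi).src.pol := by
  have hlt : (f n).length - 1 < (f n).length := by omega
  have key := (h.trial n).induction hi
    (P := fun c => T.Descends (s n).pol c ∧ c.state ∈ T.backward (s n).pol ∧
      c.pol = ((f n)[i]'hi).src.pol) ⟨h.descends n hi, hB, rfl⟩
    (fun t ht hr ⟨hd, hb, hp⟩ => ⟨hd.step ht hr, hd.tgt_mem_backward ht hr hb,
      (ht.tgt_pol_eq (hd.not_branching hb)).trans hp⟩) _ (by omega) hlt
  rw [← h.pol n _ hlt (by omega),
    ((h.trial n).valid hlt).tgt_pol_eq (key.1.not_branching key.2.1), key.2.2]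

theorem not_branching_of_mem_backward (h : T.StartsAt f s) (n : ℕ)
    (hB : (s n).state ∈ T.backward (s n).pol) {i : ℕ} (hi : i < (f n).length) :
    ¬ ((f n)[i]'hi).src.Branching := by
  refine (h.descends n hi).not_branching ?_
  refine ((h.trial n).induction (h.trial n).length_pos
    (P := fun c => T.Descends (s n).pol c ∧ c.state ∈ T.backward (s n).pol) ?_
    (fun t ht hr ⟨hd, hb⟩ => ⟨hd.step ht hr, hd.tgt_mem_backward ht hr hb⟩)
    i (Nat.zero_le _) hi).2
  exact ⟨h.descends n _, by rwa [h.head]⟩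

/-- A transition that is rewarding, or whose action leads into `backward` of the initial policy,
puts its source state into `backward` of the next initial policy. -/
theorem mem_backward_succ [Finite Q] (h : T.StartsAt f s) (n : ℕ) {i : ℕ} (hi : i < (f n).length)
    (ht : T.IsRewardStep ((f n)[i]'hi) ∨
      T.delta ((f n)[i]'hi).src.state ((f n)[i]'hi).act ⊆ T.backward (s n).pol) :
    ((f n)[i]'hi).src.state ∈ T.backward (s (n + 1)).pol := by
  have hv := (h.trial n).valid hi
  have hself := hv.tgt_pol_self
  by_cases hr : T.IsRewardStep ((f n)[i]'hi)
  · have hlen : i + 1 = (f n).length := by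
      by_contra hne
      exact (h.trial n).2.2.2.2 i (by omega) hr
    refine T.ground_subset_backward _ ?_
    rw [ground, Set.mem_ofPred_eq, ← h.pol n i hi hlen, hself]
    exact hr
  · have hsub := ht.resolve_left hr
    have hi' := (h.trial n).succ_lt hi hr
    have hchain := (h.trial n).2.1 i hi'
    have hp := h.pol_eq_of_mem_backward n hi'
      (by rw [← hchain, hv.tgt_state]; exact hsub hv.1.2)
    refine mem_backward_of_delta_subset ?_
    have hact : (s (n + 1)).pol ((f n)[i]'hi).src.state = ((f n)[i]'hi).act := by
      rw [hp, ← hchain, hself]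
    rw [hact]
    exact hsub.trans (h.monotone_backward n.le_succ)

theorem exists_backward_eq [Finite Q] (h : T.StartsAt f s) :
    ∃ N, ∀ n ≥ N, T.backward (s n).pol = T.backward (s N).pol := by
  obtain ⟨N, hN⟩ := WellFoundedGT.monotone_chain_condition ⟨_, h.monotone_backward⟩
  exact ⟨N, fun n hn => (hN n hn).symm⟩

theorem start_subset_backward [Finite Q] [Finite A] (h : T.StartsAt f s) (hred : T.Reducible)
    (hfair : T.Fair (.allFin f)) {N : ℕ}
    (hN : ∀ n ≥ N, T.backward (s n).pol = T.backward (s N).pol) :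
    T.start ⊆ T.backward (s N).pol := by
  by_contra hstart
  obtain ⟨q₀, hq₀, hq₀B⟩ := Set.not_subset.1 hstart
  set B := T.backward (s N).pol
  let C : Set (Config Q A) :=
    {c | (Run.allFin f).InfOften (fun t => t.src = c) ∧ c.state ∉ B}
  have hne : C.Nonempty := by
    obtain ⟨c, hc⟩ := (h.infinite q₀ hq₀).exists_infinite_fiber s
    refine ⟨c, Run.infOften_allFin_iff.2 fun m => ?_, ?_⟩
    · obtain ⟨n, hn, hmn⟩ := hc.exists_gt m
      exact ⟨n, hmn.le, 0, (h.trial n).length_pos, (h.head n _).trans hn.2⟩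
    · obtain ⟨n, hn, rfl⟩ := hc.nonempty
      rwa [show (s n).state = q₀ from hn]
  have hgood : ∀ c ∈ C, ∀ a, c.Branching ∨ a = c.pol c.state →
      (c.state, a) ∉ T.rewards ∧ ¬ T.delta c.state a ⊆ B := by
    intro c hc a ha
    rw [← not_or]
    intro hor
    obtain ⟨q', hq'⟩ := T.delta_nonempty c.state a
    obtain ⟨n, hn, i, hi, ht⟩ := Run.infOften_allFin_iff.1 (hfair c hc.1 (a, q') ⟨ha, hq'⟩) N
    have := h.mem_backward_succ n hi (by rw [ht, hN n hn]; exact hor)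
    rw [ht, hN (n + 1) (by omega)] at this
    exact hc.2 this
  have hnext : ∀ c ∈ C, ∀ a, c.Branching ∨ a = c.pol c.state →
      ∃ q' ∈ T.delta c.state a, c.apply a q' ∈ C := by
    intro c hc a ha
    obtain ⟨hr, hsub⟩ := hgood c hc a ha
    obtain ⟨q', hq', hq'B⟩ := Set.not_subset.1 hsub
    refine ⟨q', hq', Run.infOften_allFin_iff.2 fun m => ?_, hq'B⟩
    obtain ⟨n, hn, i, hi, ht⟩ := Run.infOften_allFin_iff.1 (hfair c hc.1 (a, q') ⟨ha, hq'⟩) m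
    have hi' := (h.trial n).succ_lt hi (by rw [ht]; exact hr)
    exact ⟨n, hn, i + 1, hi', by rw [← (h.trial n).2.1 i hi', ht]⟩
  obtain ⟨c₀, hc₀, hmax⟩ := C.toFinite.exists_maximalFor (fun c => c.mem) C hne
  have hM : ∀ c ∈ C, c.mem = c₀.mem → c.Branching := by
    intro c hc hmem
    obtain ⟨q', -, hc'⟩ := hnext c hc _ (Or.inr rfl)
    have hle : c₀.mem ⊆ c.mem ∪ {c.state} := hmem ▸ Set.subset_union_left
    have : c.mem ∪ {c.state} ⊆ c₀.mem := hmax hc' hle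
    rw [Config.Branching, hmem]
    exact this (Or.inr rfl)
  refine hred.false_of_closed (M := {c | c ∈ C ∧ c.mem = c₀.mem}) ⟨c₀, hc₀, rfl⟩
    (fun c hc a => (hgood c hc.1 a (Or.inl (hM c hc.1 hc.2))).1) fun c hc a => ?_
  have hb := hM c hc.1 hc.2
  obtain ⟨q', hq', hc'⟩ := hnext c hc.1 a (Or.inl hb)
  refine ⟨q', hq', c.apply a q', ⟨hc', ?_⟩, rfl⟩
  rw [← hc.2]
  exact Set.union_eq_left.2 (Set.singleton_subset_iff.2 hb)

end StartsAt

end NavTask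

/-- Every reducible task is learnable under fairness. -/
theorem reducible_learnable_under_fairness {Q A : Type} [Fintype Q] [Fintype A]
    (T : NavTask Q A) (hred : T.Reducible) : T.Learnable := by
  rintro (f | ⟨L, g⟩) hrun hfair
  · obtain ⟨s, hs⟩ := hrun.exists_startsAt
    obtain ⟨N, hN⟩ := hs.exists_backward_eq
    have hsub := hs.start_subset_backward hred hfair hN
    refine ⟨trivial, fun q hq => ?_⟩
    obtain ⟨n, hn, i, hi, -, hb⟩ := Run.infOften_allFin_iff.1 hq N
    exact hs.not_branching_of_mem_backward n (hN n hn ▸ hsub (hs.state n)) hi hb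
  · exact absurd hfair (NavTask.not_fair_withInf hred hrun.2.1)
end

section
/- Let T = (Q, Q₀, A, rewards, δ) be a reducible task and let R be a fair run on T. Then every trial in R is finite, i.e., terminates with a reward transition. -/
theorem Config.finite {Q A : Type} [Finite Q] [Finite A] : Finite (Config Q A) := by
  refine Finite.of_injective
    (fun c : Config Q A => (c.state, c.pol, c.mem)) ?_
  rintro ⟨q, π, V⟩ ⟨q', π', V'⟩ h
  simpa using h

namespace NavTask

variable {Q A : Type} {T : NavTask Q A} {g : ℕ → Step Q A}

/-- In an infinite trial, every departed state stays in the working memory. -/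
theorem IsInfTrial.state_mem_of_lt (hg : T.IsInfTrial g) {m n : ℕ} (h : m < n) :
    (g m).src.state ∈ (g n).src.mem := by
  have hsrc : ∀ k, (g (k + 1)).src = (g k).src.apply (g k).act (g k).nxt := fun k => by
    rw [← hg.2.1 k, (hg.1 k).2]
  induction n, h using Nat.le_induction with
  | base => rw [hsrc]; exact Or.inr rfl
  | succ n _ ih => rw [hsrc]; exact Or.inl ih

/-- A configuration that occurs infinitely often in an infinite trial is branching. -/
theorem IsInfTrial.branching_of_infinite (hg : T.IsInfTrial g) {c : Config Q A}
    (hc : {n | (g n).src = c}.Infinite) : c.Branching := by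
  obtain ⟨m, hm⟩ := hc.nonempty
  obtain ⟨n, hn, hmn⟩ := hc.exists_gt m
  have h := hg.state_mem_of_lt hmn
  rw [hm, hn] at h
  exact h

/-- A state that occurs infinitely often in an infinite trial does so in some
configuration that occurs infinitely often. -/
theorem exists_config_infinite [Finite Q] [Finite A] {q : Q}
    (hq : {n | (g n).src.state = q}.Infinite) :
    ∃ c : Config Q A, c.state = q ∧ {n | (g n).src = c}.Infinite := by
  have := Config.finite (Q := Q) (A := A)
  by_contra! h
  refine hq ((Set.finite_iUnion (fun c : {c : Config Q A // c.state = q} =>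
    h c.1 c.2)).subset fun n hn => ?_)
  exact Set.mem_iUnion.mpr ⟨⟨(g n).src, hn⟩, rfl⟩

/-- If an infinite trial ends a fair run, all options are taken infinitely often at
every state that occurs infinitely often. -/
theorem Fair.infinite_step [Finite Q] [Finite A] {L : List (List (Step Q A))}
    (hfair : T.Fair (.withInf L g)) (hg : T.IsInfTrial g) {q q' : Q} {a : A}
    (hq : {n | (g n).src.state = q}.Infinite) (hq' : q' ∈ T.delta q a) :
    {n | (g n).src.state = q ∧ (g n).act = a ∧ (g n).tgt.state = q'}.Infinite := by
  obtain ⟨c, rfl, hc⟩ := exists_config_infinite hq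
  refine (hfair c ⟨Nat.zero_le _, hc⟩ (a, q')
    ⟨Or.inl (hg.branching_of_infinite hc), hq'⟩).2.mono fun n hn => ?_
  have hn : g n = ⟨c, a, q', c.apply a q'⟩ := hn
  simp [hn, Config.apply]

/-- If an infinite trial ends a fair run, no state that is reducible to the goal states
occurs infinitely often in it. -/
theorem Fair.finite_of_mem_layers [Finite Q] [Finite A] {L : List (List (Step Q A))}
    (hfair : T.Fair (.withInf L g)) (hg : T.IsInfTrial g) (k : ℕ) {q : Q}
    (hq : q ∈ T.layers T.goals k) : {n | (g n).src.state = q}.Finite := by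
  induction k generalizing q with
  | zero =>
    obtain ⟨a, ha⟩ := hq
    obtain ⟨q', hq'⟩ := T.delta_nonempty q a
    by_contra hinf
    obtain ⟨n, hs, hact, -⟩ := (hfair.infinite_step hg hinf hq').nonempty
    exact hg.2.2 n (by rw [IsRewardStep, hs, hact]; exact ha)
  | succ k ih =>
    rcases hq with hq | ⟨a, ha⟩
    · exact ih hq
    obtain ⟨q', hq'⟩ := T.delta_nonempty q a
    by_contra hinf
    refine hfair.infinite_step hg hinf hq' (Set.Finite.subset
      ((ih (ha hq')).preimage (Nat.succ_injective.injOn)) fun n hn => ?_)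
    have h := hn.2.2
    rw [hg.2.1 n] at h
    exact h

end NavTask

/-- In a fair run on a reducible task, every trial is finite
(terminates with a reward transition). -/
theorem trials_terminate {Q A : Type} [Fintype Q] [Fintype A]
    (T : NavTask Q A) (hred : T.Reducible)
    (R : Run Q A) (hrun : T.IsRun R) (hfair : T.Fair R) :
    ∀ tr ∈ R.trials, tr.IsFinite := by
  cases R with
  | allFin f =>
    rintro _ ⟨n, rfl⟩
    trivial
  | withInf L g =>
    have hg : T.IsInfTrial g := hrun.2.1
    refine absurd (Set.infinite_univ (α := ℕ)) (Set.not_infinite.mpr ?_)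
    refine (Set.finite_iUnion (f := fun q : Q => {n | (g n).src.state = q})
      fun q => ?_).subset fun n _ => Set.mem_iUnion.mpr ⟨_, rfl⟩
    obtain ⟨k, hk⟩ := Set.mem_iUnion.mp (hred (Set.mem_univ q))
    exact hfair.finite_of_mem_layers hg k hk
end

section
/- Let T = (Q, Q₀, A, rewards, δ) be a reducible task with reducibility layers F₁ = goals(T), Fᵢ = Fᵢ₋₁ ∪ {q ∈ Q : ∃a ∈ A, δ(q,a) ⊆ Fᵢ₋₁}, and let R be a fair run on T. Then for every trial C of R and every i ≥ 1, each state of Fᵢ occurs only finitely many times in C. -/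
instance Config.finite_s2 {Q A : Type} [Finite Q] [Finite A] : Finite (Config Q A) :=
  Finite.of_injective (fun c : Config Q A => (c.state, c.pol, c.mem)) <| by
    rintro ⟨_, _, _⟩ ⟨_, _, _⟩ h
    simpa using h

namespace NavTask.IsInfTrial

variable {Q A : Type} {T : NavTask Q A} {g : ℕ → Step Q A}

theorem src_succ (hg : T.IsInfTrial g) (n : ℕ) :
    (g (n + 1)).src = (g n).src.apply (g n).act (g n).nxt := by
  rw [← hg.2.1 n, (hg.1 n).2]

theorem state_mem_mem_of_lt (hg : T.IsInfTrial g) {m n : ℕ} (h : m < n) :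
    (g m).src.state ∈ (g n).src.mem := by
  induction n, h using Nat.le_induction with
  | base => simp [hg.src_succ m, Config.apply]
  | succ n _ ih => simp [hg.src_succ n, Config.apply, ih]

/-- A configuration that recurs within one trial is branching. -/
theorem branching_of_infinite_s2 (hg : T.IsInfTrial g) {c : Config Q A}
    (hc : {n | (g n).src = c}.Infinite) : c.Branching := by
  obtain ⟨m, hm : (g m).src = c⟩ := hc.nonempty
  obtain ⟨n, hn : (g n).src = c, hmn⟩ := hc.exists_gt m
  simpa only [Config.Branching, hm, hn] using hg.state_mem_mem_of_lt hmn

theorem exists_branching_of_infinite [Finite Q] [Finite A] (hg : T.IsInfTrial g) {q : Q}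
    (hq : {n | (g n).src.state = q}.Infinite) :
    ∃ c : Config Q A, c.state = q ∧ c.Branching ∧ {n | (g n).src = c}.Infinite := by
  by_contra! hfin
  refine hq (((Set.toFinite {c : Config Q A | c.state = q}).biUnion
    (t := fun c => {n | (g n).src = c}) fun c hc => ?_).subset fun n hn => ?_)
  · by_contra hinf
    exact hinf (hfin c hc (hg.branching_of_infinite_s2 hinf))
  · exact Set.mem_biUnion (x := (g n).src) hn rfl

/-- In a fair infinite trial, every action at an infinitely recurring state is tried
infinitely often, with every possible successor. -/
theorem infinite_act_nxt [Finite Q] [Finite A] (hg : T.IsInfTrial g)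
    {L : List (List (Step Q A))} (hfair : T.Fair (.withInf L g)) {q : Q}
    (hq : {n | (g n).src.state = q}.Infinite) {a : A} {q' : Q} (hq' : q' ∈ T.delta q a) :
    {n | (g n).src.state = q ∧ (g n).act = a ∧ (g n).nxt = q'}.Infinite := by
  obtain ⟨c, rfl, hb, hc⟩ := hg.exists_branching_of_infinite hq
  refine (hfair c ⟨Nat.zero_le _, hc⟩ (a, q') ⟨.inl hb, hq'⟩).2.mono fun n hn => ?_
  rw [Set.mem_ofPred_eq] at hn
  simp [hn]

theorem finite_state_of_mem_layers [Finite Q] [Finite A] (hg : T.IsInfTrial g)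
    {L : List (List (Step Q A))} (hfair : T.Fair (.withInf L g)) (i : ℕ) :
    ∀ q ∈ T.layers T.goals i, {n | (g n).src.state = q}.Finite := by
  induction i with
  | zero =>
    rintro q ⟨a, ha⟩
    by_contra hq
    obtain ⟨q', hq'⟩ := T.delta_nonempty q a
    obtain ⟨n, rfl, rfl, -⟩ := (hg.infinite_act_nxt hfair hq hq').nonempty
    exact hg.2.2 n ha
  | succ i ih =>
    rintro q (hq | ⟨a, ha⟩)
    · exact ih q hq
    by_contra hq
    obtain ⟨q', hq'⟩ := T.delta_nonempty q a
    refine hg.infinite_act_nxt hfair hq hq' (((ih q' (ha hq')).preimage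
      (Nat.succ_injective.injOn)).subset ?_)
    rintro n ⟨-, -, rfl⟩
    simp [hg.src_succ n, Config.apply]

end NavTask.IsInfTrial

theorem Trial.finite_stateOccs_fin {Q A : Type} (l : List (Step Q A)) (q : Q) :
    ((Trial.fin l).stateOccs q).Finite := by
  refine (Set.finite_Iic l.length).subset ?_
  rintro n ⟨c, hc, -⟩
  rw [Set.mem_Iic]
  by_contra! hn
  simp [Trial.config?, hn.not_gt, hn.ne'] at hc

/-- In a fair run on a reducible task, for every trial `C` and
every reducibility layer `Fᵢ` (for goals), each state of `Fᵢ` occurs only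
finitely many times in `C`. -/
theorem layer_states_occur_finitely {Q A : Type} [Fintype Q] [Fintype A]
    (T : NavTask Q A) (hred : T.Reducible)
    (R : Run Q A) (hrun : T.IsRun R) (hfair : T.Fair R) :
    ∀ tr ∈ R.trials, ∀ i : ℕ, ∀ q ∈ T.layers T.goals i, (tr.stateOccs q).Finite := by
  intro tr htr i q hq
  have stateOccs_inf (g : ℕ → Step Q A) :
      (Trial.inf g).stateOccs q = {n | (g n).src.state = q} := by
    simp [Trial.stateOccs, Trial.config?]
  cases R with
  | allFin f =>
    obtain ⟨n, rfl⟩ := htr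
    exact Trial.finite_stateOccs_fin _ q
  | withInf L g =>
    obtain ⟨l, -, rfl⟩ | rfl := htr
    · exact Trial.finite_stateOccs_fin l q
    · rw [stateOccs_inf]
      exact hrun.2.1.finite_state_of_mem_layers hfair i q hq
end

section
/- For every task T there exists a fair run on T. -/
/-- A nonempty countable set is enumerated by a sequence hitting each element infinitely often. -/
theorem Set.Countable.exists_seq_infinite {α : Type*} {S : Set α} (hc : S.Countable)
    (hS : S.Nonempty) :
    ∃ e : ℕ → α, (∀ n, e n ∈ S) ∧ ∀ x ∈ S, {n | e n = x}.Infinite := by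
  obtain ⟨f, rfl⟩ := hc.exists_eq_range hS
  refine ⟨fun n => f n.unpair.1, fun n => ⟨_, rfl⟩, ?_⟩
  rintro _ ⟨k, rfl⟩
  refine Set.infinite_of_injective_forall_mem (f := fun m => Nat.pair k m) (fun a b h => ?_)
    (fun m => by simp)
  simpa using h

open Classical in
/-- A dynamical system may be driven by choices `e x k` depending on the current state `x` and
on the number `k` of earlier visits to `x`, with transitions which also depend on the number of
earlier occurrences of an event `R`. -/
theorem exists_seq_of_visit_counts {X Y : Type*} (e : X → ℕ → Y) (R : X → Y → Prop)
    (nxt : X → Y → ℕ → X) (x₀ : X) :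
    ∃ (x : ℕ → X) (y : ℕ → Y), x 0 = x₀ ∧
      (∀ n, y n = e (x n) (Nat.count (fun m => x m = x n) n)) ∧
      ∀ n, x (n + 1) = nxt (x n) (y n) (Nat.count (fun m => R (x m) (y m)) n) := by
  let choice : X × (X → ℕ) × ℕ → Y := fun s => e s.1 (s.2.1 s.1)
  let step : X × (X → ℕ) × ℕ → X × (X → ℕ) × ℕ := fun s =>
    (nxt s.1 (choice s) s.2.2, fun z => s.2.1 z + if s.1 = z then 1 else 0,
      s.2.2 + if R s.1 (choice s) then 1 else 0)
  let s : ℕ → X × (X → ℕ) × ℕ := fun n => step^[n] (x₀, fun _ => 0, 0)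
  have hs (n : ℕ) : s (n + 1) = step (s n) := Function.iterate_succ_apply' _ _ _
  have hv (n : ℕ) (z : X) : (s n).2.1 z = Nat.count (fun m => (s m).1 = z) n := by
    induction n with
    | zero => simp [s]
    | succ n ih => rw [Nat.count_succ, ← ih, hs]
  have hr (n : ℕ) : (s n).2.2 = Nat.count (fun m => R (s m).1 (choice (s m))) n := by
    induction n with
    | zero => simp [s]
    | succ n ih => rw [Nat.count_succ, ← ih, hs]
  refine ⟨fun n => (s n).1, fun n => choice (s n), rfl, fun n => ?_, fun n => ?_⟩
  · rw [← hv]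
  · rw [← hr]
    exact congrArg Prod.fst (hs n)

theorem Nat.infinite_setOf_add_iff (p : ℕ → Prop) (b : ℕ) :
    {n | p (b + n)}.Infinite ↔ {n | p n}.Infinite := by
  constructor
  · exact fun h => Set.infinite_of_injOn_mapsTo (add_right_injective b).injOn (fun _ hn => hn) h
  · intro h
    refine Set.Infinite.of_image (fun n => b + n) ((h.sdiff (Set.finite_lt_nat b)).mono ?_)
    rintro n ⟨hn, hbn⟩
    obtain ⟨i, rfl⟩ := Nat.exists_eq_add_of_le (not_lt.1 hbn)
    exact ⟨i, hn, rfl⟩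

/-- A strictly monotone sequence starting at `0` cuts `ℕ` into consecutive blocks. -/
theorem StrictMono.exists_le_lt_succ {b : ℕ → ℕ} (hb : StrictMono b) (h0 : b 0 = 0) (n : ℕ) :
    ∃ k, b k ≤ n ∧ n < b (k + 1) := by
  induction n with
  | zero => exact ⟨0, h0.le, h0.symm.trans_lt (hb (Nat.lt_succ_self 0))⟩
  | succ n ih =>
    obtain ⟨k, h1, h2⟩ := ih
    rcases Nat.lt_or_ge (n + 1) (b (k + 1)) with h | h
    · exact ⟨k, by omega, h⟩
    · have := hb (Nat.lt_succ_self (k + 1))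
      exact ⟨k + 1, h, by simp only [Nat.succ_eq_add_one] at this; omega⟩

namespace NavTask

variable {Q A : Type}

theorem opts_nonempty (T : NavTask Q A) (c : Config Q A) : (T.opts c).Nonempty := by
  obtain ⟨q, hq⟩ := T.delta_nonempty c.state (c.pol c.state)
  exact ⟨(c.pol c.state, q), Or.inr rfl, hq⟩

/-- A stream of valid transitions in which every reward transition is followed by a restart. -/
structure IsStream (T : NavTask Q A) (σ : ℕ → Step Q A) : Prop where
  valid : ∀ n, T.ValidStep (σ n)
  initial : T.IsStartConfig (σ 0).src
  link : ∀ n, ¬ T.IsRewardStep (σ n) → (σ n).tgt = (σ (n + 1)).src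
  restart : ∀ n, T.IsRewardStep (σ n) → T.Succession (σ n).tgt (σ (n + 1)).src

/-- Fairness of a stream of transitions. -/
def FairStream (T : NavTask Q A) (σ : ℕ → Step Q A) : Prop :=
  ∀ c : Config Q A, {n | (σ n).src = c}.Infinite →
    ∀ p ∈ T.opts c, {n | σ n = ⟨c, p.1, p.2, c.apply p.1 p.2⟩}.Infinite

open Classical in
/-- There is a fair stream of transitions in which the restart after the `k`-th reward transition
occurs at the `k`-th element of a given sequence of start states. -/
theorem exists_fairStream [Finite Q] [Finite A] (T : NavTask Q A) (st : ℕ → Q)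
    (hst : ∀ n, st n ∈ T.start) :
    ∃ σ, T.IsStream σ ∧ T.FairStream σ ∧ ∀ n, T.IsRewardStep (σ n) →
      (σ (n + 1)).src.state = st (Nat.count (fun m => T.IsRewardStep (σ m)) n) := by
  choose e he hinf using fun c : Config Q A =>
    (T.opts c).to_countable.exists_seq_infinite (T.opts_nonempty c)
  obtain ⟨⟨-, a₀⟩, -⟩ := T.rewards_nonempty
  obtain ⟨x, y, h0, hy, hx⟩ := exists_seq_of_visit_counts e
    (fun c p => (c.state, p.1) ∈ T.rewards)
    (fun c p k => if (c.state, p.1) ∈ T.rewards then ⟨st k, (c.apply p.1 p.2).pol, ∅⟩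
      else c.apply p.1 p.2)
    ⟨st 0, fun _ => a₀, ∅⟩
  refine ⟨fun n => ⟨x n, (y n).1, (y n).2, (x n).apply (y n).1 (y n).2⟩,
    ⟨fun n => ⟨?_, rfl⟩, ?_, fun n hn => ?_, fun n hn => ?_⟩, fun c hc p hp => ?_, fun n hn => ?_⟩
  · rw [hy]
    exact he _ _
  · exact ⟨by simpa [h0] using hst 0, by simp [h0]⟩
  · simp only [IsRewardStep] at hn
    simp [hx, hn]
  · simp only [IsRewardStep] at hn
    simp [hx, hn, Succession, hst]
  · refine ((hinf c p hp).image (Nat.nth_injective hc).injOn).mono ?_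
    rintro _ ⟨k, hk, rfl⟩
    have h1 : x (Nat.nth (fun n => x n = c) k) = c := Nat.nth_mem_of_infinite hc k
    have h2 : y (Nat.nth (fun n => x n = c) k) = p := by
      rw [hy, h1, Nat.count_nth_of_infinite hc]
      exact hk
    simp only [Set.mem_ofPred_eq, h1, h2]
  · exact congrArg Config.state ((hx n).trans (if_pos hn))

end NavTask

/-- The list of the transitions of `σ` at the positions `n` with `a ≤ n < b`. -/
def transitions {Q A : Type} (σ : ℕ → Step Q A) (a b : ℕ) : List (Step Q A) :=
  (List.range (b - a)).map fun i => σ (a + i)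

namespace NavTask

variable {Q A : Type} {T : NavTask Q A} {σ : ℕ → Step Q A}

theorem length_transitions (a b : ℕ) : (transitions σ a b).length = b - a := by simp [transitions]

theorem getElem_transitions (a b i : ℕ) (h : i < (transitions σ a b).length) :
    (transitions σ a b)[i] = σ (a + i) := by simp [transitions]

theorem firstSrc?_transitions {a b : ℕ} (h : a < b) :
    firstSrc? (transitions σ a b) = some (σ a).src := by
  obtain ⟨k, rfl⟩ := Nat.exists_eq_add_of_lt h
  simp [firstSrc?, transitions, List.head?_range, show a + k + 1 - a = k + 1 by omega]

theorem getLast?_transitions {a r : ℕ} (h : a ≤ r) :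
    (transitions σ a (r + 1)).getLast? = some (σ r) := by
  obtain ⟨k, rfl⟩ := Nat.exists_eq_add_of_le h
  simp [transitions, List.getLast?_range, show a + k + 1 - a = k + 1 by omega]

theorem lastTgt?_transitions {a r : ℕ} (h : a ≤ r) :
    lastTgt? (transitions σ a (r + 1)) = some (σ r).tgt := by
  simp [lastTgt?, getLast?_transitions h]

theorem IsStream.isFinTrial_transitions (hσ : T.IsStream σ) {a r : ℕ} (har : a ≤ r)
    (hr : T.IsRewardStep (σ r)) (hn : ∀ n, a ≤ n → n < r → ¬ T.IsRewardStep (σ n)) :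
    T.IsFinTrial (transitions σ a (r + 1)) := by
  refine ⟨?_, fun i h => ?_, fun t ht => ?_, ?_, fun i h => ?_⟩
  · rw [← List.length_pos_iff, length_transitions]
    omega
  · rw [length_transitions] at h
    rw [getElem_transitions, getElem_transitions]
    exact hσ.link _ (hn _ (by omega) (by omega))
  · obtain ⟨i, -, rfl⟩ := List.mem_map.1 ht
    exact hσ.valid _
  · rw [getLast?_transitions har]
    simpa using hr
  · rw [length_transitions] at h
    rw [getElem_transitions]
    exact hn _ (by omega) (by omega)

variable (T σ) in
/-- The position in the stream `σ` at which the `k`-th trial starts. -/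
noncomputable def trialStart : ℕ → ℕ
  | 0 => 0
  | k + 1 => Nat.nth (fun n => T.IsRewardStep (σ n)) k + 1

theorem trialStart_succ (k : ℕ) :
    trialStart T σ (k + 1) = Nat.nth (fun n => T.IsRewardStep (σ n)) k + 1 := rfl

variable (T σ) in
/-- The stream `σ` has more than `k` reward transitions. -/
def MoreRewards (k : ℕ) : Prop :=
  ∀ hf : {n | T.IsRewardStep (σ n)}.Finite, k < hf.toFinset.card

theorem MoreRewards.mono {k l : ℕ} (h : MoreRewards T σ l) (hkl : k ≤ l) : MoreRewards T σ k :=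
  fun hf => hkl.trans_lt (h hf)

theorem trialStart_lt_succ {k : ℕ} (h : MoreRewards T σ k) :
    trialStart T σ k < trialStart T σ (k + 1) := by
  cases k with
  | zero => exact Nat.succ_pos _
  | succ k => exact Nat.succ_lt_succ (Nat.nth_lt_nth' (Nat.lt_succ_self k) h)

theorem trialStart_mono {k l : ℕ} (hkl : k ≤ l) (h : ∀ m < l, MoreRewards T σ m) :
    trialStart T σ k ≤ trialStart T σ l := by
  induction l, hkl using Nat.le_induction with
  | base => rfl
  | succ l _ ih =>
    exact (ih fun m hm => h m (hm.trans (Nat.lt_succ_self l))).trans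
      (trialStart_lt_succ (h l (Nat.lt_succ_self l))).le

variable (T σ) in
/-- The `k`-th trial of the stream `σ`. -/
noncomputable def streamTrial (k : ℕ) : List (Step Q A) :=
  transitions σ (trialStart T σ k) (trialStart T σ (k + 1))

theorem firstSrc?_streamTrial {k : ℕ} (h : MoreRewards T σ k) :
    firstSrc? (streamTrial T σ k) = some (σ (trialStart T σ k)).src :=
  firstSrc?_transitions (trialStart_lt_succ h)

theorem lastTgt?_streamTrial {k : ℕ} (h : MoreRewards T σ k) :
    lastTgt? (streamTrial T σ k) =
      some (σ (Nat.nth (fun n => T.IsRewardStep (σ n)) k)).tgt :=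
  lastTgt?_transitions (Nat.lt_succ_iff.1 (trialStart_lt_succ h))

theorem IsStream.isFinTrial_streamTrial (hσ : T.IsStream σ) {k : ℕ} (h : MoreRewards T σ k) :
    T.IsFinTrial (streamTrial T σ k) := by
  refine hσ.isFinTrial_transitions (Nat.lt_succ_iff.1 (trialStart_lt_succ h)) (Nat.nth_mem k h) ?_
  intro n h1 h2 hn
  obtain ⟨m, hm, rfl⟩ := Nat.exists_lt_card_nth_eq (p := fun n => T.IsRewardStep (σ n)) hn
  rcases Nat.lt_or_ge m k with hmk | hmk
  · have := trialStart_mono (T := T) (σ := σ) hmk fun j hj => h.mono hj.le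
    rw [Nat.succ_eq_add_one, trialStart_succ] at this
    omega
  · exact (Nat.nth_le_nth' hmk hm).not_gt h2

theorem IsStream.succession_streamTrial (hσ : T.IsStream σ) {k : ℕ} (h : MoreRewards T σ k) :
    ∀ c₁ ∈ lastTgt? (streamTrial T σ k),
      T.Succession c₁ (σ (trialStart T σ (k + 1))).src := by
  rw [lastTgt?_streamTrial h]
  rintro _ ⟨⟩
  exact hσ.restart _ (Nat.nth_mem k h)

/-- The trials of a stream with infinitely many reward transitions contain infinitely many
transitions with a given property iff the stream does. -/
theorem infOften_allFin_iff (hinf : {n | T.IsRewardStep (σ n)}.Infinite) (P : Step Q A → Prop) :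
    (Run.allFin (streamTrial T σ)).InfOften P ↔ {n | P (σ n)}.Infinite := by
  have hb : StrictMono (trialStart T σ) :=
    strictMono_nat_of_lt_succ fun k => trialStart_lt_succ fun hf => (hinf hf).elim
  have hmem (k i : ℕ) : (∃ h : i < (streamTrial T σ k).length, P ((streamTrial T σ k)[i]'h)) ↔
      trialStart T σ k + i < trialStart T σ (k + 1) ∧ P (σ (trialStart T σ k + i)) := by
    simp only [streamTrial, getElem_transitions, length_transitions, exists_prop,
      Nat.lt_sub_iff_add_lt']
  simp only [Run.InfOften, Run.InfOftenFrom, hmem]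
  constructor
  · intro h
    refine Set.infinite_of_injOn_mapsTo (f := fun p : ℕ × ℕ => trialStart T σ p.1 + p.2) ?_
      (fun p hp => hp.2.2) h
    rintro ⟨k, i⟩ ⟨-, hk, -⟩ ⟨l, j⟩ ⟨-, hl, -⟩ heq
    simp only at hk hl heq
    obtain rfl : k = l := by
      rcases lt_trichotomy k l with hkl | hkl | hkl
      · have := hb.monotone (Nat.succ_le_of_lt hkl)
        simp only [Nat.succ_eq_add_one] at this
        omega
      · exact hkl
      · have := hb.monotone (Nat.succ_le_of_lt hkl)
        simp only [Nat.succ_eq_add_one] at this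
        omega
    simpa using heq
  · intro h
    refine Set.Infinite.of_image (fun p : ℕ × ℕ => trialStart T σ p.1 + p.2) (h.mono ?_)
    intro n hn
    obtain ⟨k, h1, h2⟩ := hb.exists_le_lt_succ rfl n
    obtain ⟨i, rfl⟩ := Nat.exists_eq_add_of_le h1
    exact ⟨(k, i), ⟨Nat.zero_le _, h2, hn⟩, rfl⟩

open Classical in
theorem IsStream.isRun_allFin (hσ : T.IsStream σ) (hinf : {n | T.IsRewardStep (σ n)}.Infinite)
    {st : ℕ → Q} (hst : ∀ q ∈ T.start, {n | st n = q}.Infinite)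
    (hrestart : ∀ n, T.IsRewardStep (σ n) →
      (σ (n + 1)).src.state = st (Nat.count (fun m => T.IsRewardStep (σ m)) n)) :
    T.IsRun (.allFin (streamTrial T σ)) := by
  have hm (k : ℕ) : MoreRewards T σ k := fun hf => (hinf hf).elim
  refine ⟨fun n => hσ.isFinTrial_streamTrial (hm n), ?_, fun n c₁ hc₁ => ?_, fun q hq => ?_⟩
  · rw [firstSrc?_streamTrial (hm 0)]
    rintro _ ⟨⟩
    exact hσ.initial
  · rw [firstSrc?_streamTrial (hm _)]
    rintro _ ⟨⟩
    exact hσ.succession_streamTrial (hm n) c₁ hc₁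
  · refine Set.infinite_of_injOn_mapsTo (add_left_injective 1).injOn (fun k hk => ?_) (hst q hq)
    refine ⟨_, firstSrc?_streamTrial (hm _), ?_⟩
    exact (hrestart _ (Nat.nth_mem_of_infinite hinf k)).trans
      ((congrArg st (Nat.count_nth_of_infinite hinf k)).trans hk)

theorem IsStream.isRun_withInf (hσ : T.IsStream σ) (hfin : {n | T.IsRewardStep (σ n)}.Finite) :
    T.IsRun (.withInf ((List.range hfin.toFinset.card).map (streamTrial T σ))
      fun n => σ (trialStart T σ hfin.toFinset.card + n)) := by
  set N := hfin.toFinset.card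
  have hm {k : ℕ} (hk : k < N) : MoreRewards T σ k := fun _ => hk
  have hnot (n : ℕ) : ¬ T.IsRewardStep (σ (trialStart T σ N + n)) := by
    intro hn
    obtain ⟨m, hmN, hmn⟩ := Nat.exists_lt_card_nth_eq (p := fun n => T.IsRewardStep (σ n)) hn
    have := trialStart_mono (T := T) (σ := σ) (show m + 1 ≤ N from hmN hfin) fun j hj => hm hj
    rw [trialStart_succ] at this
    omega
  refine ⟨?_, ⟨fun n => hσ.valid _, fun n => hσ.link _ (hnot n), hnot⟩, ?_, ?_, ?_, ?_⟩
  · intro l hl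
    obtain ⟨k, hk, rfl⟩ := List.mem_map.1 hl
    exact hσ.isFinTrial_streamTrial (hm (List.mem_range.1 hk))
  · intro h
    have h0 : N = 0 := by simpa using h
    simpa [h0, trialStart] using hσ.initial
  · rcases Nat.eq_zero_or_pos N with h0 | h0
    · simp [h0]
    · simp only [List.head?_map, List.head?_range, h0.ne', if_false, Option.map_some,
        Option.mem_some_iff, forall_eq', firstSrc?_streamTrial (hm h0)]
      exact hσ.initial
  · intro i h c₁ hc₁
    simp only [List.length_map, List.length_range] at h
    simp only [List.getElem_map, List.getElem_range] at hc₁ ⊢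
    rw [firstSrc?_streamTrial (hm h)]
    rintro _ ⟨⟩
    exact hσ.succession_streamTrial (hm (Nat.lt_of_succ_lt h)) c₁ hc₁
  · rcases hk : N with _ | k
    · simp [lastTgt?]
    · simpa [List.getLast?_range] using
        hσ.succession_streamTrial (hm (hk ▸ Nat.lt_succ_self k))

end NavTask

/-- For every task there is a fair run. -/
theorem exists_fair_run {Q A : Type} [Fintype Q] [Fintype A] (T : NavTask Q A) :
    ∃ R : Run Q A, T.IsRun R ∧ T.Fair R := by
  obtain ⟨st, hst, hst'⟩ := T.start.to_countable.exists_seq_infinite T.start_nonempty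
  obtain ⟨σ, hσ, hfair, hrestart⟩ := T.exists_fairStream st hst
  by_cases h : {n | T.IsRewardStep (σ n)}.Finite
  · refine ⟨_, hσ.isRun_withInf h, fun c hc p hp => ⟨Nat.zero_le _, ?_⟩⟩
    rw [Nat.infinite_setOf_add_iff fun n => σ n = _]
    exact hfair c ((Nat.infinite_setOf_add_iff (fun n => (σ n).src = c) _).1 hc.2) p hp
  · refine ⟨_, hσ.isRun_allFin h hst' hrestart, fun c hc p hp => ?_⟩
    rw [NavTask.infOften_allFin_iff h] at hc ⊢
    exact hfair c hc p hp
end
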